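/- Finite propagation speed support bound on the torus (the support claim used in the proofs of Theorems 1.3, 1.15 and Propositions 2.1, 2.3): For every even Schwartz function ψ : ℝ → ℂ whose Fourier transform ψ̂ has compact support contained in [−1,1], there exists a constant C > 0 (depending only on d and ψ) such that for every finite complex Borel measure μ on 𝕋^d and every R ≥ 1, the absolutely convergent sum P_Rμ(x) := Σ_j ψ(|j|/R) μ̂(j) e_j(x) vanishes at every point x ∈ 𝕋^d with dist(x, supp μ) > C/R; equivalently, the support of the continuous function P_Rμ is contained in the thickening (supp μ)^{C/R}. -/

import Mathlib

open MeasureTheory Complex Filter FourierTransform Metric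
open scoped Real

noncomputable section

abbrev Torus (d : ℕ) := Fin d → AddCircle (1 : ℝ)

/-- The character `e_j(x) = ∏ m, exp(2πi j_m x_m)` on the torus. -/
def torusChar {d : ℕ} (j : Fin d → ℤ) (x : Torus d) : ℂ :=
  ∏ m, fourier (j m) (x m)

/-- `|j| = (Σ_m j_m²)^{1/2}` for a frequency `j : Fin d → ℤ`. -/
def jnorm {d : ℕ} (j : Fin d → ℤ) : ℝ :=
  Real.sqrt (∑ m, ((j m : ℝ)) ^ 2)

/-- Integration of a complex-valued function against a finite complex measure,
via the Jordan decompositions of the real and imaginary parts. -/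
def cIntegral {X : Type*} [MeasurableSpace X] (μ : ComplexMeasure X) (f : X → ℂ) : ℂ :=
  ((∫ x, f x ∂((ComplexMeasure.re μ).toJordanDecomposition.posPart))
    - (∫ x, f x ∂((ComplexMeasure.re μ).toJordanDecomposition.negPart)))
  + Complex.I * ((∫ x, f x ∂((ComplexMeasure.im μ).toJordanDecomposition.posPart))
    - (∫ x, f x ∂((ComplexMeasure.im μ).toJordanDecomposition.negPart)))

/-- The Fourier coefficient `μ̂(j) = ∫ conj (e_j) dμ` of a finite complex measure. -/
def muHat {d : ℕ} (μ : ComplexMeasure (Torus d)) (j : Fin d → ℤ) : ℂ :=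
  cIntegral μ (fun x => starRingEnd ℂ (torusChar j x))

/-- `a_n(μ) = ‖E_{√n} μ‖ = (Σ_{|j|² = n} |μ̂(j)|²)^{1/2}`, the `L²` norm of the spectral
projection of `μ` onto the Laplace eigenspace with eigenvalue `-n`. -/
def aCoeff {d : ℕ} (μ : ComplexMeasure (Torus d)) (n : ℕ) : ℝ :=
  Real.sqrt (∑' j : {j : Fin d → ℤ // (∑ m, (j m) ^ 2) = (n : ℤ)}, ‖muHat μ (j : Fin d → ℤ)‖ ^ 2)

/-- The topological support of a complex measure: the set of points all of whose
neighborhoods contain a measurable set of nonzero measure. -/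
def msupport {X : Type*} [TopologicalSpace X] [MeasurableSpace X] (μ : ComplexMeasure X) : Set X :=
  {x | ∀ U : Set X, IsOpen U → x ∈ U → ∃ A : Set X, MeasurableSet A ∧ A ⊆ U ∧ μ A ≠ 0}


open scoped BoundedContinuousFunction Topology

/-- primitive -/
def primI (φ : ℝ →ᵇ ℂ) (s : ℝ) : ℂ :=
  ∫ u in (min |s| 1)..1, (-(2 * (π:ℂ) ^ 2)) * ((u : ℂ) * φ u)

lemma primI_cont (φ : ℝ →ᵇ ℂ) : Continuous (primI φ) := by
  have h : Continuous fun u : ℝ => (-(2 * (π:ℂ) ^ 2)) * ((u : ℂ) * φ u) := by fun_prop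
  have h2 : Continuous fun x : ℝ => ∫ u in (1:ℝ)..x, (-(2 * (π:ℂ) ^ 2)) * ((u : ℂ) * φ u) :=
    intervalIntegral.continuous_primitive (fun a b => h.intervalIntegrable a b) 1
  have h3 : primI φ = fun s => - (fun x : ℝ => ∫ u in (1:ℝ)..x, (-(2 * (π:ℂ) ^ 2)) * ((u : ℂ) * φ u)) (min |s| 1) := by
    funext s
    simp only [primI]
    rw [intervalIntegral.integral_symm]
  rw [h3]
  exact (h2.comp (by fun_prop)).neg

lemma primI_bound (φ : ℝ →ᵇ ℂ) (s : ℝ) : ‖primI φ s‖ ≤ 2 * π ^ 2 * ‖φ‖ := by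
  have hm : 0 ≤ min |s| 1 := le_min (abs_nonneg s) zero_le_one
  have hm1 : min |s| 1 ≤ 1 := min_le_right _ _
  have := intervalIntegral.norm_integral_le_of_norm_le_const (a := min |s| 1) (b := 1)
    (f := fun u : ℝ => (-(2 * (π:ℂ) ^ 2)) * ((u : ℂ) * φ u)) (C := 2 * π ^ 2 * ‖φ‖) (by
      intro u hu
      rw [Set.uIoc_of_le hm1] at hu
      have h0 : 0 ≤ u := hm.trans hu.1.le
      have e : ‖(-(2 * (π:ℂ) ^ 2)) * ((u : ℂ) * φ u)‖ = 2 * π ^ 2 * (u * ‖φ u‖) := by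
        simp [abs_of_nonneg h0, abs_of_nonneg Real.pi_pos.le]
      rw [e]
      have : u * ‖φ u‖ ≤ 1 * ‖φ‖ := mul_le_mul hu.2 (φ.norm_coe_le_norm u) (norm_nonneg _) zero_le_one
      have hp : 0 ≤ 2 * π ^ 2 := by positivity
      nlinarith)
  refine this.trans ?_
  have : |1 - min |s| 1| ≤ 1 := by rw [abs_le]; constructor <;> linarith
  have h2 : 0 ≤ 2 * π ^ 2 * ‖φ‖ := by positivity
  nlinarith

def opT : (ℝ →ᵇ ℂ) →L[ℝ] (ℝ →ᵇ ℂ) :=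
  LinearMap.mkContinuous
    { toFun := fun φ => BoundedContinuousFunction.ofNormedAddCommGroup (primI φ) (primI_cont φ) _ (primI_bound φ)
      map_add' := by
        intro f g
        ext s
        simp only [BoundedContinuousFunction.coe_ofNormedAddCommGroup, primI, BoundedContinuousFunction.coe_add, Pi.add_apply]
        rw [← intervalIntegral.integral_add]
        · congr 1; ext u; ring
        · exact Continuous.intervalIntegrable (by fun_prop) _ _
        · exact Continuous.intervalIntegrable (by fun_prop) _ _
      map_smul' := by
        intro c f
        ext s
        simp only [BoundedContinuousFunction.coe_ofNormedAddCommGroup, primI, BoundedContinuousFunction.coe_smul, RingHom.id_apply]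
        rw [← intervalIntegral.integral_smul]
        congr 1; ext u; simp only [Complex.real_smul]; ring }
    (2 * π ^ 2) (by
      intro φ
      exact BoundedContinuousFunction.norm_ofNormedAddCommGroup_le _ (by positivity) (primI_bound φ))

lemma opT_apply (φ : ℝ →ᵇ ℂ) (s : ℝ) : opT φ s = primI φ s := rfl

def flow (φ : ℝ →ᵇ ℂ) (b : ℝ) : ℝ →ᵇ ℂ := NormedSpace.exp (b • opT) φ

lemma flow_zero (φ : ℝ →ᵇ ℂ) : flow φ 0 = φ := by
  have h : (0:ℝ) • opT = 0 := by ext; simp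
  simp only [flow]
  rw [h, NormedSpace.exp_zero]
  rfl

lemma flow_deriv (φ : ℝ →ᵇ ℂ) (b : ℝ) : HasDerivAt (flow φ) (opT (flow φ b)) b := by
  have h := hasDerivAt_exp_smul_const' (𝕂 := ℝ) opT b
  have := h.clm_apply (hasDerivAt_const b φ)
  simp only [map_zero, add_zero] at this
  exact this

lemma flow_deriv_apply (φ : ℝ →ᵇ ℂ) (b s : ℝ) :
    HasDerivAt (fun b => flow φ b s) (primI (flow φ b) s) b := by
  have := (BoundedContinuousFunction.evalCLM ℝ s : (ℝ →ᵇ ℂ) →L[ℝ] ℂ).hasFDerivAt.comp_hasDerivAt b (flow_deriv φ b)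
  exact this

lemma flow_cont (φ : ℝ →ᵇ ℂ) : Continuous (flow φ) :=
  continuous_iff_continuousAt.2 fun b => (flow_deriv φ b).continuousAt

lemma primI_zero (φ : ℝ →ᵇ ℂ) (s : ℝ) (hs : 1 ≤ |s|) : primI φ s = 0 := by
  simp [primI, min_eq_right hs]

lemma primI_even (φ : ℝ →ᵇ ℂ) (s : ℝ) : primI φ (-s) = primI φ s := by
  simp [primI]

lemma flow_zero_outside (φ : ℝ →ᵇ ℂ) (hφ : ∀ s, 1 ≤ |s| → φ s = 0) (b s : ℝ) (hs : 1 ≤ |s|) :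
    flow φ b s = 0 := by
  have := is_const_of_deriv_eq_zero (f := fun b => flow φ b s)
    (fun b => (flow_deriv_apply φ b s).differentiableAt)
    (fun b => by rw [(flow_deriv_apply φ b s).deriv, primI_zero _ _ hs]) b 0
  simp only [flow_zero] at this
  rw [this, hφ s hs]

lemma flow_even (φ : ℝ →ᵇ ℂ) (hφ : ∀ s, φ (-s) = φ s) (b s : ℝ) :
    flow φ b (-s) = flow φ b s := by
  have hd : ∀ b, HasDerivAt (fun b => flow φ b (-s) - flow φ b s) 0 b := fun b => by
    have := (flow_deriv_apply φ b (-s)).sub (flow_deriv_apply φ b s)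
    rw [primI_even, sub_self] at this
    exact this
  have := is_const_of_deriv_eq_zero (f := fun b => flow φ b (-s) - flow φ b s)
    (fun b => (hd b).differentiableAt)
    (fun b => (hd b).deriv) b 0
  simp only [flow_zero, hφ, sub_self] at this
  exact sub_eq_zero.1 this

lemma primI_deriv (φ : ℝ →ᵇ ℂ) (s : ℝ) (hs : s ∈ Set.Ioo (0:ℝ) 1) :
    HasDerivAt (primI φ) (2 * (π:ℂ) ^ 2 * (s * φ s)) s := by
  have h : Continuous fun u : ℝ => (-(2 * (π:ℂ) ^ 2)) * ((u : ℂ) * φ u) := by fun_prop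
  have h1 := intervalIntegral.integral_hasDerivAt_left (h.intervalIntegrable s 1)
    (h.stronglyMeasurableAtFilter _ _) h.continuousAt
  have h2 : primI φ =ᶠ[𝓝 s] fun s => ∫ u in s..1, (-(2 * (π:ℂ) ^ 2)) * ((u : ℂ) * φ u) := by
    filter_upwards [Ioo_mem_nhds hs.1 hs.2] with x hx
    simp only [primI]
    rw [abs_of_pos hx.1, min_eq_left hx.2.le]
  refine (h1.congr_of_eventuallyEq h2).congr_deriv (by ring)

/-- cosine transform -/
def cosT (f : ℝ → ℂ) (t : ℝ) : ℂ := ∫ s in (0:ℝ)..1, f s * Complex.cos (2 * π * s * t)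

lemma parts (φ : ℝ →ᵇ ℂ) (t : ℝ) (ht : 0 < t) :
    ∫ s in (0:ℝ)..1, (primI φ s * Complex.cos (2 * π * s * t)
      + φ s * (π * s / t * Complex.sin (2 * π * s * t))) = 0 := by
  have hc := primI_cont φ
  have ht' : (t:ℂ) ≠ 0 := by exact_mod_cast ht.ne'
  have hp' : (π:ℂ) ≠ 0 := by exact_mod_cast Real.pi_ne_zero
  have := intervalIntegral.integral_eq_sub_of_hasDerivAt_of_le (a := 0) (b := 1) zero_le_one
    (f := fun s : ℝ => primI φ s * (Complex.sin (2 * π * s * t) / (2 * π * t)))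
    (f' := fun s : ℝ => (primI φ s * Complex.cos (2 * π * s * t)
      + φ s * (π * s / t * Complex.sin (2 * π * s * t))))
    (by fun_prop) (by
      intro s hs
      have h1 := primI_deriv φ s hs
      have h2 : HasDerivAt (fun s : ℂ => (2 * π * s * t : ℂ)) (2 * π * t) (s:ℂ) := by
        refine (((hasDerivAt_id (s:ℂ)).const_mul (2 * π : ℂ)).mul_const (t:ℂ)).congr_deriv ?_
        ring
      have h3 := ((h2.csin).div_const (2 * π * t : ℂ)).comp_ofReal
      refine (h1.mul h3).congr_deriv ?_
      field_simp
      ring) (Continuous.intervalIntegrable (by fun_prop) _ _)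
  rw [this]
  simp [primI_zero]

lemma eval_cont (g : ℝ → ℝ →ᵇ ℂ) (hg : Continuous g) : Continuous fun p : ℝ × ℝ => g p.1 p.2 :=
  continuous_eval.comp ((hg.comp continuous_fst).prodMk continuous_snd)

lemma cosT_flow (φ : ℝ →ᵇ ℂ) (b t : ℝ) (hb : 0 ≤ b) :
    cosT (flow φ b) |t| = cosT φ (Real.sqrt (b + t ^ 2)) := by
  set c := b + t ^ 2 with hc
  let F : ℝ → ℝ → ℂ := fun b s => flow φ b s * Complex.cos (2 * π * s * (Real.sqrt (c - b) : ℝ))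
  let F' : ℝ → ℝ → ℂ := fun b s => opT (flow φ b) s * Complex.cos (2 * π * s * (Real.sqrt (c - b) : ℝ))
      + flow φ b s * (π * s / (Real.sqrt (c - b) : ℝ) * Complex.sin (2 * π * s * (Real.sqrt (c - b) : ℝ)))
  have e1 := eval_cont _ (flow_cont φ)
  have e2 := eval_cont (fun b => opT (flow φ b)) (opT.continuous.comp (flow_cont φ))
  have hcF : Continuous (Function.uncurry F) := by
    simp only [F, Function.uncurry_def]
    fun_prop
  have hFc : ∀ y, Continuous (F y) := by
    intro y
    simp only [F]
    fun_prop
  have key := constant_of_has_deriv_right_zero (a := 0) (b := b)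
    (f := fun b => ∫ s in (0:ℝ)..1, F b s)
    (intervalIntegral.continuous_parametric_intervalIntegral_of_continuous' hcF 0 1).continuousOn (by
      intro x hx
      apply HasDerivAt.hasDerivWithinAt
      have hxc : x < c := by nlinarith [hx.2, sq_nonneg t]
      have hm : (x + c) / 2 < c := by linarith
      have hK : IsCompact (Set.Icc (x-1) ((x+c)/2) ×ˢ Set.Icc (0:ℝ) 1) := isCompact_Icc.prod isCompact_Icc
      have hpos : ∀ y ∈ Set.Icc (x-1) ((x+c)/2), 0 < Real.sqrt (c - y) := by
        intro y hy
        apply Real.sqrt_pos.2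
        linarith [hy.2]
      obtain ⟨M, hM⟩ := hK.exists_bound_of_continuousOn (f := Function.uncurry F') (by
        simp only [F', Function.uncurry_def]
        have h1 : ContinuousOn (fun p : ℝ × ℝ => (π * p.2 / (Real.sqrt (c - p.1) : ℝ) : ℂ)) 
          (Set.Icc (x-1) ((x+c)/2) ×ˢ Set.Icc (0:ℝ) 1) := by
          apply ContinuousOn.div
          · fun_prop
          · fun_prop
          · intro p hp
            exact_mod_cast (hpos p.1 hp.1).ne'
        fun_prop)
      have hFx := hFc x
      have hmain := (intervalIntegral.hasDerivAt_integral_of_dominated_loc_of_deriv_le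
        (μ := volume) (a := 0) (b := 1) (F := F) (F' := F') (x₀ := x) (bound := fun _ => M)
        (s := Set.Icc (x-1) ((x+c)/2)) (Icc_mem_nhds (by linarith) (by linarith))
        (Eventually.of_forall fun y => by
          have : Continuous (F y) := hFc y
          exact this.aestronglyMeasurable)
        (hFx.intervalIntegrable _ _)
        (by
          have : Continuous (F' x) := by
            simp only [F']
            fun_prop
          exact this.aestronglyMeasurable)
        (Eventually.of_forall fun s hs y hy => by
          rw [Set.uIoc_of_le zero_le_one] at hs
          exact hM (y, s) ⟨hy, ⟨hs.1.le, hs.2⟩⟩)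
        (by simp)
        (Eventually.of_forall fun s hs y hy => by
          have hp := hpos y hy
          have hcy : c - y ≠ 0 := by
            intro h; rw [h] at hp; simp at hp
          have d1 := flow_deriv_apply φ y s
          have d2 := (((hasDerivAt_id y).const_sub c).sqrt hcy).ofReal_comp.const_mul (2 * π * s : ℂ)
          have d3 := (Complex.hasDerivAt_cos _).comp y d2
          refine (d1.mul d3).congr_deriv ?_
          simp only [F', opT_apply, id, Function.comp]
          have hp' : (Real.sqrt (c - y) : ℂ) ≠ 0 := by exact_mod_cast hp.ne'
          push_cast
          field_simp)).2
      have hz := parts (flow φ x) (Real.sqrt (c - x)) (Real.sqrt_pos.2 (by linarith))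
      simp only [F', opT_apply] at hmain
      rw [hz] at hmain
      exact hmain) b ⟨hb, le_rfl⟩
  simp only [F, flow_zero, sub_zero] at key
  have : c - b = t ^ 2 := by rw [hc]; ring
  rw [this, Real.sqrt_sq_eq_abs] at key
  exact key

lemma fourier_even (f : ℝ → ℂ) (hf : Continuous f) (he : ∀ s, f (-s) = f s)
    (hz : ∀ s, 1 ≤ |s| → f s = 0) (t : ℝ) : 𝓕 f t = 2 * cosT f t := by
  rw [Real.fourier_real_eq_integral_exp_smul]
  have hc : Continuous fun v : ℝ => Complex.exp (↑(-2 * π * v * t) * Complex.I) • f v := by fun_prop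
  rw [← intervalIntegral.integral_eq_integral_of_support_subset (a := -1) (b := 1) (by
    intro v hv
    have hv' : f v ≠ 0 := by
      intro h; apply hv; simp [h]
    have : |v| < 1 := by
      by_contra h
      exact hv' (hz v (not_lt.1 h))
    rw [abs_lt] at this
    exact ⟨this.1, this.2.le⟩)]
  rw [← intervalIntegral.integral_add_adjacent_intervals (b := 0) (hc.intervalIntegrable _ _) (hc.intervalIntegrable _ _)]
  have h1 : ∫ v in (-1:ℝ)..0, Complex.exp (↑(-2 * π * v * t) * Complex.I) • f v =
      ∫ v in (0:ℝ)..1, Complex.exp (↑(-2 * π * (-v) * t) * Complex.I) • f (-v) := by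
    rw [intervalIntegral.integral_comp_neg (fun v => Complex.exp (↑(-2 * π * v * t) * Complex.I) • f v)]
    simp
  rw [h1, ← intervalIntegral.integral_add (Continuous.intervalIntegrable (by fun_prop) _ _) (hc.intervalIntegrable _ _),
    cosT, ← intervalIntegral.integral_const_mul]
  congr 1
  ext v
  rw [he, Complex.cos]
  simp only [smul_eq_mul]
  push_cast
  have e1 : (-2 * π * -v * t * Complex.I : ℂ) = 2 * π * v * t * Complex.I := by ring
  have e2 : (-2 * π * v * t * Complex.I : ℂ) = -(2 * π * v * t) * Complex.I := by ring
  rw [e1, e2]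
  ring

lemma cosT_abs (f : ℝ → ℂ) (t : ℝ) : cosT f |t| = cosT f t := by
  rcases abs_cases t with ⟨h, _⟩ | ⟨h, _⟩
  · rw [h]
  · rw [h]; simp [cosT]

lemma exists_Phi (ψ : SchwartzMap ℝ ℂ) (hψeven : ∀ t : ℝ, ψ (-t) = ψ t)
    (hψhat' : Function.support (𝓕 ⇑ψ) ⊆ Set.Icc (-1) 1) (b : ℝ) (hb : 0 ≤ b) :
    ∃ Φ : ℝ → ℂ, Continuous Φ ∧ (∀ s, 1 ≤ |s| → Φ s = 0) ∧
      ∀ t, 𝓕 Φ t = ψ (Real.sqrt (b + t ^ 2)) := by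
  have hcoe : ⇑(𝓕 ψ : SchwartzMap ℝ ℂ) = 𝓕 ⇑ψ := SchwartzMap.fourier_coe ψ
  have hcont : Continuous (𝓕 ⇑ψ) := by rw [← hcoe]; exact (𝓕 ψ : SchwartzMap ℝ ℂ).continuous
  have hev : ∀ s, 𝓕 ⇑ψ (-s) = 𝓕 ⇑ψ s := by
    intro s
    rw [Real.fourier_real_eq_integral_exp_smul, Real.fourier_real_eq_integral_exp_smul,
      ← integral_neg_eq_self]
    congr 1
    ext v
    rw [hψeven]
    congr 3
    push_cast; ring
  have hz0 : ∀ s, 1 < s → 𝓕 ⇑ψ s = 0 := by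
    intro s hs
    by_contra h
    exact absurd (hψhat' h).2 (not_le.2 hs)
  have hz1 : ∀ s, 1 ≤ s → 𝓕 ⇑ψ s = 0 := by
    have hcl : IsClosed {s | 𝓕 ⇑ψ s = 0} := isClosed_eq hcont continuous_const
    have : closure (Set.Ioi (1:ℝ)) ⊆ {s | 𝓕 ⇑ψ s = 0} := hcl.closure_subset_iff.2 hz0
    rw [closure_Ioi] at this
    exact this
  have hz : ∀ s, 1 ≤ |s| → 𝓕 ⇑ψ s = 0 := by
    intro s hs
    rcases abs_cases s with ⟨h, _⟩ | ⟨h, _⟩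
    · exact hz1 s (h ▸ hs)
    · rw [← hev]; exact hz1 _ (h ▸ hs)
  obtain ⟨C, hC⟩ : ∃ C, ∀ s, ‖𝓕 ⇑ψ s‖ ≤ C := by
    obtain ⟨C, hC⟩ := (isCompact_Icc (a := (-1:ℝ)) (b := 1)).exists_bound_of_continuousOn hcont.continuousOn
    refine ⟨max C 0, fun s => ?_⟩
    by_cases hs : s ∈ Set.Icc (-1:ℝ) 1
    · exact (hC s hs).trans (le_max_left _ _)
    · have : 𝓕 ⇑ψ s = 0 := by
        by_contra h; exact hs (hψhat' h)
      rw [this]; simp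
  let φ : ℝ →ᵇ ℂ := BoundedContinuousFunction.ofNormedAddCommGroup (𝓕 ⇑ψ) hcont C hC
  have hφ : ⇑φ = 𝓕 ⇑ψ := rfl
  refine ⟨flow φ b, (flow φ b).continuous, flow_zero_outside φ hz b, fun t => ?_⟩
  rw [fourier_even _ (flow φ b).continuous (flow_even φ hev b) (flow_zero_outside φ hz b),
    ← cosT_abs, cosT_flow φ b t hb, ← fourier_even φ φ.continuous hev hz, hφ]
  have : 𝓕⁻ (𝓕 ψ : SchwartzMap ℝ ℂ) = ψ := FourierTransform.fourierInv_fourier_eq ψ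
  have h2 := congrArg (fun f : SchwartzMap ℝ ℂ => f (-Real.sqrt (b + t^2))) this
  simp only [hψeven] at h2
  rw [← h2, SchwartzMap.fourierInv_coe, hcoe, Real.fourierInv_eq_fourier_neg, neg_neg]

lemma schwartz_decay (ψ : SchwartzMap ℝ ℂ) (N : ℕ) : ∃ C, 0 ≤ C ∧ ∀ t, (1 + t ^ 2) ^ N * ‖ψ t‖ ≤ C := by
  have h := ψ.one_add_le_sup_seminorm_apply (𝕜 := ℝ) (m := (2 * N, 0)) (k := 2 * N) (n := 0) le_rfl le_rfl
  have h2 : ∀ t, (1 + t ^ 2) ^ N * ‖ψ t‖ ≤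
      2 ^ (2 * N, 0).1 * ((Finset.Iic (2 * N, 0)).sup fun m => SchwartzMap.seminorm ℝ m.1 m.2) ψ := by
    intro t
    have := h t
    rw [norm_iteratedFDeriv_zero] at this
    refine le_trans ?_ this
    gcongr
    rw [pow_mul]
    gcongr
    rw [Real.norm_eq_abs]
    nlinarith [abs_nonneg t, sq_abs t]
  exact ⟨_, le_trans (by positivity) (h2 0), h2⟩

lemma one_dim (ψ : SchwartzMap ℝ ℂ) (hψeven : ∀ t : ℝ, ψ (-t) = ψ t)
    (hψhat' : Function.support (𝓕 ⇑ψ) ⊆ Set.Icc (-1) 1) (b : ℝ) (hb : 0 ≤ b) (R : ℝ) (hR : 1 ≤ R)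
    (x : ℝ) (hx : ∀ n : ℤ, 1 / R ≤ |x + n|) :
    ∑' n : ℤ, ψ (Real.sqrt (b + (n / R) ^ 2)) * fourier n (x : UnitAddCircle) = 0 := by
  obtain ⟨Φ, hc, hz, hF⟩ := exists_Phi ψ hψeven hψhat' b hb
  have hR0 : 0 < R := by linarith
  let f : ℝ → ℂ := fun s => R * Φ (R * s)
  have hf0 : ∀ s, 1 / R ≤ |s| → f s = 0 := by
    intro s hs
    simp only [f]
    rw [hz, mul_zero]
    rw [abs_mul, abs_of_pos hR0]
    rwa [div_le_iff₀' hR0] at hs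
  have hFf : ∀ w, 𝓕 f w = ψ (Real.sqrt (b + (w / R) ^ 2)) := by
    intro w
    rw [← hF, Real.fourier_real_eq_integral_exp_smul, Real.fourier_real_eq_integral_exp_smul]
    have := Measure.integral_comp_mul_left (fun u : ℝ => Complex.exp (↑(-2 * π * u * (w / R)) * Complex.I) • Φ u) R
    rw [abs_of_pos (inv_pos.2 hR0)] at this
    have h2 := congrArg (fun z : ℂ => (R:ℂ) * z) this
    simp only [Complex.real_smul] at h2
    rw [← mul_assoc] at h2
    have hRc : (R:ℂ) ≠ 0 := by exact_mod_cast hR0.ne'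
    rw [Complex.ofReal_inv, mul_inv_cancel₀ hRc, one_mul] at h2
    rw [← h2, ← integral_const_mul]
    congr 1
    ext v
    simp only [f, smul_eq_mul]
    have : -2 * π * (R * v) * (w / R) = -2 * π * v * w := by field_simp
    rw [this]; ring
  have hP := Real.tsum_eq_tsum_fourier_of_rpow_decay (f := f) (b := 2) (by fun_prop) one_lt_two (by
      apply Asymptotics.IsBigO.of_bound 1
      filter_upwards [(isCompact_closedBall (0:ℝ) (1/R)).compl_mem_cocompact] with s hs
      rw [hf0 s (by
        simp only [Set.mem_compl_iff, mem_closedBall, dist_zero_right, Real.norm_eq_abs, not_le] at hs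
        exact hs.le)]
      simp; positivity) (by
      obtain ⟨C, hC0, hC⟩ := schwartz_decay ψ 1
      apply Asymptotics.IsBigO.of_bound (C * R ^ 2)
      filter_upwards [(isCompact_singleton (x := (0:ℝ))).compl_mem_cocompact] with s hs
      have hs' : s ≠ 0 := hs
      have hp : 0 < s ^ 2 := by positivity
      rw [hFf]
      have := hC (Real.sqrt (b + (s / R) ^ 2))
      rw [Real.sq_sqrt (by positivity), pow_one] at this
      have e : ‖|s| ^ (-2 : ℝ)‖ = (s ^ 2)⁻¹ := by
        rw [Real.norm_of_nonneg (by positivity), Real.rpow_neg (abs_nonneg _)]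
        norm_num
      rw [e, ← div_eq_mul_inv, le_div_iff₀ hp]
      have h3 : (s / R)^2 * ‖ψ (Real.sqrt (b + (s / R) ^ 2))‖ ≤ C := by
        refine le_trans ?_ this
        gcongr
        linarith
      rw [mul_comm]
      calc s ^ 2 * ‖ψ (Real.sqrt (b + (s / R) ^ 2))‖ 
          = ((s / R)^2 * ‖ψ (Real.sqrt (b + (s / R) ^ 2))‖) * R ^ 2 := by field_simp
        _ ≤ _ := by gcongr) x
  simp only [hFf] at hP
  rw [← hP]
  simp [fun n : ℤ => hf0 _ (hx n)]

lemma summable_prod_pi (g : ℤ → ℝ) (hg0 : ∀ n, 0 ≤ g n) (hg : Summable g) (d : ℕ) :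
    Summable fun j : Fin d → ℤ => ∏ m, g (j m) := by
  induction d with
  | zero => exact Summable.of_finite
  | succ d ih =>
    rw [← (Fin.insertNthEquiv (fun _ => ℤ) (0 : Fin (d+1))).summable_iff]
    have := hg.mul_of_nonneg ih hg0 (fun j => Finset.prod_nonneg fun m _ => hg0 _)
    refine this.congr fun p => ?_
    simp [Fin.prod_univ_succ, Fin.insertNthEquiv]

lemma summable_psi (ψ : SchwartzMap ℝ ℂ) (d : ℕ) (R : ℝ) (hR : 1 ≤ R) :
    Summable fun j : Fin d → ℤ => ‖ψ (jnorm j / R)‖ := by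
  have hR0 : 0 < R := by linarith
  obtain ⟨C, hC0, hC⟩ := schwartz_decay ψ d
  have hg : Summable fun n : ℤ => (1 + (n / R) ^ 2)⁻¹ := by
    have h2 : Summable fun n : ℤ => R ^ 2 * (1 / (n:ℝ) ^ 2) := 
      (Real.summable_one_div_int_pow.2 one_lt_two).mul_left _
    refine Summable.of_norm_bounded_eventually h2 ?_
    rw [eventually_cofinite]
    refine (Set.finite_singleton (0:ℤ)).subset ?_
    intro n hn
    by_contra hn0
    apply hn
    have : (n:ℝ) ≠ 0 := by exact_mod_cast hn0
    have h1 : R ^ 2 * (1 / (n:ℝ) ^ 2) = ((n / R) ^ 2)⁻¹ := by field_simp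
    rw [h1, Real.norm_of_nonneg (by positivity)]
    gcongr
    linarith
  have := (summable_prod_pi _ (fun n => by positivity) hg d).mul_left C
  refine Summable.of_nonneg_of_le (fun _ => norm_nonneg _) (fun j => ?_) this
  have hle : ∏ m : Fin d, (1 + ((j m : ℝ) / R) ^ 2) ≤ (1 + (jnorm j / R) ^ 2) ^ d := by
    calc _ ≤ ∏ m : Fin d, (1 + (jnorm j / R) ^ 2) := by
          refine Finset.prod_le_prod (fun _ _ => by positivity) fun m _ => ?_
          apply add_le_add_right
          rw [div_pow, div_pow, jnorm, Real.sq_sqrt (Finset.sum_nonneg fun _ _ => sq_nonneg _)]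
          gcongr
          exact Finset.single_le_sum (f := fun m => (j m : ℝ) ^ 2) (fun _ _ => sq_nonneg _) (Finset.mem_univ m)
      _ = _ := by simp
  rw [Finset.prod_inv_distrib, ← div_eq_mul_inv, le_div_iff₀ (Finset.prod_pos fun m _ => by positivity)]
  refine le_trans ?_ (hC (jnorm j / R))
  rw [mul_comm]
  gcongr

lemma torusChar_cont {d : ℕ} (j : Fin d → ℤ) : Continuous (torusChar j) := by
  unfold torusChar
  fun_prop

lemma torusChar_norm {d : ℕ} (j : Fin d → ℤ) (x : Torus d) : ‖torusChar j x‖ = 1 := by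
  simp only [torusChar, fourier_apply, norm_prod]
  exact Finset.prod_eq_one fun m _ => Circle.norm_coe _

lemma torusChar_sub {d : ℕ} (j : Fin d → ℤ) (x y : Torus d) :
    starRingEnd ℂ (torusChar j y) * torusChar j x = torusChar j (x - y) := by
  simp only [torusChar, map_prod]
  rw [← Finset.prod_mul_distrib]
  refine Finset.prod_congr rfl fun m _ => ?_
  rw [← fourier_neg]
  simp only [fourier_apply, Pi.sub_apply]
  rw [← Circle.coe_mul, ← AddCircle.toCircle_add]
  congr 2
  rw [neg_smul, smul_sub]
  abel

lemma kernel_zero (d : ℕ) (ψ : SchwartzMap ℝ ℂ) (hψeven : ∀ t : ℝ, ψ (-t) = ψ t)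
    (hψhat' : Function.support (𝓕 ⇑ψ) ⊆ Set.Icc (-1) 1) (R : ℝ) (hR : 1 ≤ R)
    (z : Torus d) (m : Fin d) (hz : 1 / R ≤ ‖z m‖) :
    ∑' j : Fin d → ℤ, ψ (jnorm j / R) * torusChar j z = 0 := by
  obtain _ | d := d
  · exact m.elim0
  have hR0 : 0 < R := by linarith
  let e := (Fin.insertNthEquiv (fun _ => ℤ) m)
  have hs : Summable fun j : Fin (d+1) → ℤ => ψ (jnorm j / R) * torusChar j z := by
    refine Summable.of_norm ((summable_psi ψ (d+1) R hR).congr fun j => ?_)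
    rw [norm_mul, torusChar_norm, mul_one]
  rw [← e.tsum_eq, ← (Equiv.prodComm _ _).tsum_eq]
  have hs2 := (Equiv.prodComm _ _).summable_iff.2 (e.summable_iff.2 hs)
  have hs3 := hs2.tsum_prod
  refine Eq.trans hs3 ?_
  refine Eq.trans (tsum_congr (g := fun _ => 0) fun j' => ?_) tsum_zero
  obtain ⟨x, hx⟩ := QuotientAddGroup.mk_surjective (z m)
  have hx' : z m = (x : UnitAddCircle) := hx.symm
  have h1 := one_dim ψ hψeven hψhat' (∑ k, ((j' k : ℝ) / R) ^ 2) (Finset.sum_nonneg fun _ _ => sq_nonneg _) R hR x (by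
    intro n
    refine hz.trans ?_
    rw [hx', UnitAddCircle.norm_eq]
    have := round_le x (-n)
    push_cast at this
    rwa [sub_neg_eq_add] at this)
  have h2 := congrArg (fun w => w * ∏ k, fourier (j' k) (z (m.succAbove k))) h1
  simp only [zero_mul] at h2
  rw [← h2, ← tsum_mul_right]
  refine tsum_congr fun n => ?_
  simp only [Function.comp, Equiv.prodComm_apply, Prod.swap_prod_mk, e, Fin.insertNthEquiv, Equiv.coe_fn_mk]
  rw [mul_assoc]
  congr 2
  · rw [jnorm, Fin.sum_univ_succAbove _ m]
    simp only [Fin.insertNth_apply_same, Fin.insertNth_apply_succAbove]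
    simp only [div_pow]
    rw [← Finset.sum_div, ← add_div, Real.sqrt_div' _ (sq_nonneg R), Real.sqrt_sq hR0.le, add_comm]
  · rw [torusChar, Fin.prod_univ_succAbove _ m]
    simp only [Fin.insertNth_apply_same, Fin.insertNth_apply_succAbove]
    rw [hx']

lemma hasSum_part {d : ℕ} (ν : Measure (Torus d)) [IsFiniteMeasure ν] (S : Set (Torus d))
    (hν : ν Sᶜ = 0) (x : Torus d) (c : (Fin d → ℤ) → ℂ) (hc : Summable fun j => ‖c j‖)
    (hx : ∀ y ∈ S, ∑' j, c j * torusChar j (x - y) = 0) :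
    HasSum (fun j => c j * (∫ y, starRingEnd ℂ (torusChar j y) ∂ν) * torusChar j x) 0 := by
  have hcont : ∀ j, Continuous fun y => c j * torusChar j (x - y) := fun j =>
    continuous_const.mul ((torusChar_cont j).comp (by fun_prop))
  have hn : ∀ j y, ‖c j * torusChar j (x - y)‖ = ‖c j‖ := fun j y => by
    rw [norm_mul, torusChar_norm, mul_one]
  have h := hasSum_integral_of_summable_integral_norm (μ := ν)
    (F := fun j y => c j * torusChar j (x - y))
    (fun j => Integrable.of_bound (hcont j).aestronglyMeasurable ‖c j‖
      (Eventually.of_forall fun y => (hn j y).le))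
    (by
      simp only [hn, integral_const, smul_eq_mul]
      exact hc.mul_left _)
  have h0 : ∫ y, ∑' j, c j * torusChar j (x - y) ∂ν = 0 := by
    apply integral_eq_zero_of_ae
    have : ∀ᵐ y ∂ν, y ∈ S := by
      rw [ae_iff]; exact hν
    filter_upwards [this] with y hy
    exact hx y hy
  rw [h0] at h
  refine Eq.mp (congrArg (fun F : (Fin d → ℤ) → ℂ => HasSum F 0) (funext fun j => ?_)) h
  symm
  rw [mul_assoc, ← integral_mul_const, ← integral_const_mul]
  simp only [torusChar_sub]

lemma jordan_null {X : Type*} [TopologicalSpace X] [MeasurableSpace X] [SecondCountableTopology X]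
    [OpensMeasurableSpace X] (s : SignedMeasure X) (S : Set X)
    (hS : ∀ x ∉ S, ∃ U, IsOpen U ∧ x ∈ U ∧ ∀ A, MeasurableSet A → A ⊆ U → s A = 0) :
    s.toJordanDecomposition.posPart Sᶜ = 0 ∧ s.toJordanDecomposition.negPart Sᶜ = 0 := by
  obtain ⟨i, hi1, hi2, hi3, hp, hn⟩ := s.toJordanDecomposition_spec
  constructor
  · refine measure_null_of_locally_null _ fun x hx => ?_
    obtain ⟨U, hU, hxU, h⟩ := hS x hx
    refine ⟨U, mem_nhdsWithin_of_mem_nhds (hU.mem_nhds hxU), ?_⟩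
    rw [hp, SignedMeasure.toMeasureOfZeroLE_apply _ _ hi1 hU.measurableSet]
    have := h (i ∩ U) (hi1.inter hU.measurableSet) Set.inter_subset_right
    simp only [this]
    rfl
  · refine measure_null_of_locally_null _ fun x hx => ?_
    obtain ⟨U, hU, hxU, h⟩ := hS x hx
    refine ⟨U, mem_nhdsWithin_of_mem_nhds (hU.mem_nhds hxU), ?_⟩
    rw [hn, SignedMeasure.toMeasureOfLEZero_apply _ _ hi1.compl hU.measurableSet]
    have := h (iᶜ ∩ U) (hi1.compl.inter hU.measurableSet) Set.inter_subset_right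
    simp only [this, neg_zero]
    rfl

lemma muHat_bound {d : ℕ} (μ : ComplexMeasure (Torus d)) : ∃ M, ∀ j, ‖muHat μ j‖ ≤ M := by
  have hb : ∀ (ν : Measure (Torus d)) [IsFiniteMeasure ν] (j : Fin d → ℤ),
      ‖∫ y, starRingEnd ℂ (torusChar j y) ∂ν‖ ≤ ν.real Set.univ := by
    intro ν _ j
    have := norm_integral_le_of_norm_le_const (μ := ν) (f := fun y => starRingEnd ℂ (torusChar j y)) (C := 1)
      (Eventually.of_forall fun y => by simp [torusChar_norm])
    simpa using this
  refine ⟨((ComplexMeasure.re μ).toJordanDecomposition.posPart.real Set.univ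
    + (ComplexMeasure.re μ).toJordanDecomposition.negPart.real Set.univ)
    + ((ComplexMeasure.im μ).toJordanDecomposition.posPart.real Set.univ
    + (ComplexMeasure.im μ).toJordanDecomposition.negPart.real Set.univ), fun j => ?_⟩
  unfold muHat cIntegral
  refine (norm_add_le _ _).trans (add_le_add ((norm_sub_le _ _).trans (add_le_add (hb _ j) (hb _ j))) ?_)
  rw [norm_mul, Complex.norm_I, one_mul]
  exact (norm_sub_le _ _).trans (add_le_add (hb _ j) (hb _ j))

theorem finite_propagation_support_torus
    (d : ℕ) (hd : 1 ≤ d)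
    (ψ : SchwartzMap ℝ ℂ) (hψeven : ∀ t : ℝ, ψ (-t) = ψ t)
    (hψhat : HasCompactSupport (𝓕 ⇑ψ))
    (hψhat' : Function.support (𝓕 ⇑ψ) ⊆ Set.Icc (-1) 1) :
    ∃ C : ℝ, 0 < C ∧
      ∀ (μ : ComplexMeasure (Torus d)) (R : ℝ), 1 ≤ R →
        Summable (fun j : Fin d → ℤ => ‖(ψ (jnorm j / R)) * muHat μ j‖) ∧
        Function.support (fun x : Torus d =>
            ∑' j : Fin d → ℤ, (ψ (jnorm j / R)) * muHat μ j * torusChar j x)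
          ⊆ Metric.thickening (C / R) (msupport μ) := by
  refine ⟨1, one_pos, fun μ R hR => ⟨?_, ?_⟩⟩
  · obtain ⟨M, hM⟩ := muHat_bound μ
    refine Summable.of_nonneg_of_le (fun _ => norm_nonneg _) (fun j => ?_)
      ((summable_psi ψ d R hR).mul_right M)
    rw [norm_mul]
    gcongr
    exact hM j
  · intro x hx
    by_contra hxt
    apply hx
    have hR0 : 0 < 1 / R := by positivity
    have hK : ∀ y ∈ msupport μ, ∑' j, ψ (jnorm j / R) * torusChar j (x - y) = 0 := by
      intro y hy
      have hdist : 1 / R ≤ dist x y := by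
        by_contra h
        exact hxt (Metric.mem_thickening_iff.2 ⟨y, hy, not_le.1 h⟩)
      have : ∃ m, 1 / R ≤ dist (x m) (y m) := by
        by_contra! h
        exact absurd ((dist_pi_lt_iff hR0).2 h) (not_lt.2 hdist)
      obtain ⟨m, hm⟩ := this
      rw [dist_eq_norm] at hm
      exact kernel_zero d ψ hψeven hψhat' R hR (x - y) m hm
    have hloc : ∀ y ∉ msupport μ, ∃ U, IsOpen U ∧ y ∈ U ∧ ∀ A, MeasurableSet A → A ⊆ U → μ A = 0 := by
      intro y hy
      simp only [msupport, Set.mem_ofPred_eq] at hy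
      push Not at hy
      obtain ⟨U, h1, h2, h3⟩ := hy
      exact ⟨U, h1, h2, h3⟩
    obtain ⟨r1, r2⟩ := jordan_null (ComplexMeasure.re μ) (msupport μ) (by
      intro y hy
      obtain ⟨U, h1, h2, h3⟩ := hloc y hy
      refine ⟨U, h1, h2, fun A hA hAU => ?_⟩
      have : ComplexMeasure.re μ A = (μ A).re := rfl
      rw [this, h3 A hA hAU, Complex.zero_re])
    obtain ⟨i1, i2⟩ := jordan_null (ComplexMeasure.im μ) (msupport μ) (by
      intro y hy
      obtain ⟨U, h1, h2, h3⟩ := hloc y hy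
      refine ⟨U, h1, h2, fun A hA hAU => ?_⟩
      have : ComplexMeasure.im μ A = (μ A).im := rfl
      rw [this, h3 A hA hAU, Complex.zero_im])
    have hc := summable_psi ψ d R hR
    have s1 := hasSum_part _ _ r1 x _ hc hK
    have s2 := hasSum_part _ _ r2 x _ hc hK
    have s3 := hasSum_part _ _ i1 x _ hc hK
    have s4 := hasSum_part _ _ i2 x _ hc hK
    have := ((s1.sub s2).add ((s3.sub s4).mul_left Complex.I)).tsum_eq
    simp only [sub_zero, mul_zero, add_zero] at this
    rw [← this]
    refine tsum_congr fun j => ?_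
    simp only [muHat, cIntegral]
    ring
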